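/- (Theorem 1) Consider the distributed gradient-tracking algorithm with each f_i α-strongly convex and β-smooth (0 < α ≤ β), and let x* be the unique minimizer of f and f* = f(x*). Let λ = max(|1 − αη|, |1 − βη|) and let G(η) be the 3×3 real matrix with rows (σ + βη, β(ηβ + 2), ηβ²), (η, σ, 0), (0, ηβ, λ). If the step size η > 0 is such that the spectral radius ρ(G(η)) < 1, then there exists a constant C > 0 such that for all t ≥ 0 and all agents i: ‖x̄(t) − x*‖ ≤ C·ρ(G(η))^t, ‖x(t) − 𝟙x̄(t)‖ ≤ C·ρ(G(η))^t, ‖s(t) − 𝟙g(t)‖ ≤ C·ρ(G(η))^t, and f(x_i(t)) − f* ≤ C·ρ(G(η))^{2t}. -/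

import Mathlib

open scoped BigOperators RealInnerProductSpace
open Filter

noncomputable section

abbrev Vec (N : ℕ) := EuclideanSpace ℝ (Fin N)

/-- Frobenius norm of a stacked matrix in `ℝ^{n×N}`, viewed as `n` rows in `ℝ^N`. -/
def fro {n N : ℕ} (A : Fin n → Vec N) : ℝ := Real.sqrt (∑ i, ‖A i‖ ^ 2)

/-- Spectral norm (largest singular value) of a square real matrix, as the operator norm
of the induced linear map between Euclidean spaces. -/
def specNorm {n : ℕ} (M : Matrix (Fin n) (Fin n) ℝ) : ℝ :=
  ‖LinearMap.toContinuousLinearMap (Matrix.toEuclideanLin M)‖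

/-- Spectral radius of a square real matrix: the maximum modulus of its complex
eigenvalues. -/
def specRad {k : ℕ} (M : Matrix (Fin k) (Fin k) ℝ) : ℝ :=
  (spectralRadius ℂ (M.map (algebraMap ℝ ℂ))).toReal

section Frobenius

variable {n N : ℕ}

lemma fro_eq_norm (A : Fin n → Vec N) : fro A = ‖WithLp.toLp 2 A‖ := by
  simp [fro, PiLp.norm_eq_of_L2]

lemma fro_nonneg (A : Fin n → Vec N) : 0 ≤ fro A := Real.sqrt_nonneg _

lemma fro_sq (A : Fin n → Vec N) : fro A ^ 2 = ∑ i, ‖A i‖ ^ 2 :=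
  Real.sq_sqrt (Finset.sum_nonneg fun _ _ => sq_nonneg _)

lemma fro_add_le (A B : Fin n → Vec N) : fro (A + B) ≤ fro A + fro B := by
  simpa only [fro_eq_norm, WithLp.toLp_add] using norm_add_le _ _

lemma fro_sub_le (A B : Fin n → Vec N) : fro (A - B) ≤ fro A + fro B := by
  simpa only [fro_eq_norm, WithLp.toLp_sub] using norm_sub_le _ _

lemma fro_smul (c : ℝ) (A : Fin n → Vec N) : fro (c • A) = |c| * fro A := by
  simp only [fro_eq_norm, WithLp.toLp_smul, norm_smul, Real.norm_eq_abs]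

lemma fro_const (v : Vec N) : fro (fun _ : Fin n => v) = √n * ‖v‖ := by
  simp [fro]

lemma norm_le_fro (A : Fin n → Vec N) (i : Fin n) : ‖A i‖ ≤ fro A := by
  rw [fro_eq_norm]
  exact PiLp.norm_apply_le (WithLp.toLp 2 A) i

lemma fro_le_mul_fro {A B : Fin n → Vec N} {c : ℝ} (hc : 0 ≤ c)
    (h : ∀ i, ‖A i‖ ≤ c * ‖B i‖) : fro A ≤ c * fro B := by
  refine le_of_sq_le_sq ?_ (mul_nonneg hc (fro_nonneg B))
  rw [mul_pow, fro_sq, fro_sq, Finset.mul_sum]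
  refine Finset.sum_le_sum fun i _ => ?_
  rw [← mul_pow]
  exact pow_le_pow_left₀ (norm_nonneg _) (h i) 2

/-- The average of the rows of a stacked matrix. -/
def rowMean (A : Fin n → Vec N) : Vec N := (n : ℝ)⁻¹ • ∑ i, A i

lemma smul_rowMean (hn : 0 < n) (A : Fin n → Vec N) : (n : ℝ) • rowMean A = ∑ i, A i := by
  rw [rowMean, smul_inv_smul₀ (by positivity)]

lemma rowMean_sub (A B : Fin n → Vec N) : rowMean (A - B) = rowMean A - rowMean B := by
  simp [rowMean, smul_sub]

lemma rowMean_add (A B : Fin n → Vec N) : rowMean (A + B) = rowMean A + rowMean B := by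
  simp [rowMean, Finset.sum_add_distrib]

lemma rowMean_smul (c : ℝ) (A : Fin n → Vec N) : rowMean (c • A) = c • rowMean A := by
  simp [rowMean, ← Finset.smul_sum, smul_comm c]

lemma fro_sq_eq_deviation_add_mean (hn : 0 < n) (A : Fin n → Vec N) :
    fro A ^ 2 = fro (fun i => A i - rowMean A) ^ 2 + n * ‖rowMean A‖ ^ 2 := by
  have h : ∑ i, ⟪A i, rowMean A⟫ = n * ‖rowMean A‖ ^ 2 := by
    rw [← sum_inner, ← smul_rowMean hn, real_inner_smul_left, real_inner_self_eq_norm_sq]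
  simp only [fro_sq, norm_sub_sq_real, Finset.sum_add_distrib, Finset.sum_sub_distrib,
    ← Finset.mul_sum, h, Finset.sum_const, Finset.card_univ, Fintype.card_fin, nsmul_eq_mul]
  ring

lemma fro_deviation_le (hn : 0 < n) (A : Fin n → Vec N) :
    fro (fun i => A i - rowMean A) ≤ fro A := by
  refine le_of_sq_le_sq ?_ (fro_nonneg A)
  rw [fro_sq_eq_deviation_add_mean hn A]
  exact le_add_of_nonneg_right (by positivity)

lemma sqrt_mul_norm_rowMean_le (hn : 0 < n) (A : Fin n → Vec N) :
    √n * ‖rowMean A‖ ≤ fro A := by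
  refine le_of_sq_le_sq ?_ (fro_nonneg A)
  rw [fro_sq_eq_deviation_add_mean hn A, mul_pow, Real.sq_sqrt (Nat.cast_nonneg n)]
  exact le_add_of_nonneg_left (by positivity)

/-- The product of a square matrix with a stacked matrix. -/
def mix (M : Matrix (Fin n) (Fin n) ℝ) (A : Fin n → Vec N) : Fin n → Vec N :=
  fun i => ∑ j, M i j • A j

lemma fro_mix_le (M : Matrix (Fin n) (Fin n) ℝ) (A : Fin n → Vec N) :
    fro (mix M A) ≤ specNorm M * fro A := by
  refine le_of_sq_le_sq ?_ (mul_nonneg (norm_nonneg _) (fro_nonneg A))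
  have column (k : Fin N) : ∑ i, (mix M A i k) ^ 2 ≤ specNorm M ^ 2 * ∑ i, (A i k) ^ 2 := by
    have h := pow_le_pow_left₀ (norm_nonneg _)
      ((LinearMap.toContinuousLinearMap (Matrix.toEuclideanLin M)).le_opNorm
        (WithLp.toLp 2 fun j => A j k)) 2
    rw [mul_pow, EuclideanSpace.norm_sq_eq, EuclideanSpace.norm_sq_eq] at h
    simpa [specNorm, mix, Matrix.toLpLin_apply, Matrix.mulVec, dotProduct] using h
  rw [mul_pow, fro_sq, fro_sq]
  simp only [EuclideanSpace.norm_sq_eq, Real.norm_eq_abs, sq_abs]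
  rw [Finset.sum_comm, Finset.sum_comm (f := fun i k => (A i k) ^ 2), Finset.mul_sum]
  exact Finset.sum_le_sum fun k _ => column k

lemma rowMean_mix {W : Matrix (Fin n) (Fin n) ℝ} (hcol : ∀ j, ∑ i, W i j = 1)
    (A : Fin n → Vec N) : rowMean (mix W A) = rowMean A := by
  simp only [rowMean, mix]
  rw [Finset.sum_comm]
  simp [← Finset.sum_smul, hcol]

lemma mix_deviation (hn : 0 < n) {W : Matrix (Fin n) (Fin n) ℝ} (hrow : ∀ i, ∑ j, W i j = 1)
    (A : Fin n → Vec N) :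
    mix (W - (n : ℝ)⁻¹ • Matrix.of (fun _ _ => (1 : ℝ))) (fun i => A i - rowMean A) =
      fun i => mix W A i - rowMean A := by
  have hn' : (n : ℝ) ≠ 0 := by positivity
  funext i
  have h : ∑ j, (n : ℝ)⁻¹ • A j = rowMean A := by rw [rowMean, Finset.smul_sum]
  simp [mix, sub_smul, smul_sub, Finset.sum_sub_distrib, ← Finset.sum_smul, hrow, h, hn',
    ← Nat.cast_smul_eq_nsmul ℝ]

lemma fro_mix_deviation_le (hn : 0 < n) {W : Matrix (Fin n) (Fin n) ℝ}
    (hrow : ∀ i, ∑ j, W i j = 1) (A : Fin n → Vec N) :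
    fro (fun i => mix W A i - rowMean A) ≤
      specNorm (W - (n : ℝ)⁻¹ • Matrix.of (fun _ _ => (1 : ℝ))) *
        fro (fun i => A i - rowMean A) := by
  rw [← mix_deviation hn hrow]
  exact fro_mix_le _ _

end Frobenius

section QuadraticBounds

variable {E : Type*} [NormedAddCommGroup E] [InnerProductSpace ℝ E]

/-- A differentiable function with `β`-Lipschitz gradient lies below its quadratic model. -/
lemma le_quadratic_of_gradient_lipschitz [CompleteSpace E] {f : E → ℝ} {β : ℝ}
    (hf : Differentiable ℝ f)
    (hlip : ∀ u v, ‖gradient f u - gradient f v‖ ≤ β * ‖u - v‖) (u v : E) :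
    f v ≤ f u + ⟪gradient f u, v - u⟫ + β / 2 * ‖v - u‖ ^ 2 := by
  set d := v - u with hd
  have line (t : ℝ) : HasDerivAt (fun t : ℝ => f (u + t • d)) ⟪gradient f (u + t • d), d⟫ t := by
    have h1 : HasDerivAt (fun t : ℝ => u + t • d) d t := by
      simpa using ((hasDerivAt_id t).smul_const d).const_add u
    exact (hf (u + t • d)).hasGradientAt.hasFDerivAt.comp_hasDerivAt t h1
  have gap (t : ℝ) : HasDerivAt
      (fun t : ℝ => β / 2 * ‖d‖ ^ 2 * t ^ 2 + t * ⟪gradient f u, d⟫ - f (u + t • d))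
      (β * ‖d‖ ^ 2 * t + ⟪gradient f u, d⟫ - ⟪gradient f (u + t • d), d⟫) t := by
    have h := (((hasDerivAt_pow 2 t).const_mul (β / 2 * ‖d‖ ^ 2)).add
      ((hasDerivAt_id t).mul_const ⟪gradient f u, d⟫)).sub (line t)
    refine h.congr_deriv ?_
    push_cast
    ring
  have mono := monotoneOn_of_deriv_nonneg (convex_Icc (0 : ℝ) 1)
    (fun t _ => (gap t).continuousAt.continuousWithinAt)
    (fun t _ => (gap t).differentiableAt.differentiableWithinAt) (by
      intro t ht
      rw [interior_Icc] at ht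
      rw [(gap t).deriv]
      have h1 : ⟪gradient f (u + t • d) - gradient f u, d⟫ ≤ β * ‖d‖ ^ 2 * t := by
        calc _ ≤ ‖gradient f (u + t • d) - gradient f u‖ * ‖d‖ := real_inner_le_norm _ _
          _ ≤ β * ‖u + t • d - u‖ * ‖d‖ := by gcongr; exact hlip _ _
          _ = β * ‖d‖ ^ 2 * t := by
            rw [add_sub_cancel_left, norm_smul, Real.norm_of_nonneg ht.1.le]
            ring
      rw [inner_sub_left] at h1
      linarith)
  have h := mono (Set.left_mem_Icc.2 zero_le_one) (Set.right_mem_Icc.2 zero_le_one) zero_le_one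
  have hv : u + d = v := by rw [hd]; abel
  simp only [zero_smul, one_smul, add_zero, hv] at h
  linarith

variable {F : E → ℝ} {F' : E → E} {α β : ℝ}

/-- If `F` lies between quadratic models of curvatures `α` and `β`, then its gradient deviates
from the linear map of slope `(α + β) / 2` by at most `(β - α) / 2`. -/
lemma norm_sub_midpoint_le (hαβ : α ≤ β)
    (lower : ∀ u v, F u + ⟪F' u, v - u⟫ + α / 2 * ‖v - u‖ ^ 2 ≤ F v)
    (upper : ∀ u v, F v ≤ F u + ⟪F' u, v - u⟫ + β / 2 * ‖v - u‖ ^ 2) (x y : E) :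
    ‖(F' x - F' y) - ((α + β) / 2) • (x - y)‖ ≤ (β - α) / 2 * ‖x - y‖ := by
  have half (x y q : E) (hq : q = F' x - F' y - α • (x - y)) (s : ℝ) :
      F y - F x + ⟪F' y, x - y⟫ + α / 2 * ‖x - y‖ ^ 2
        ≤ (β - α) / 2 * s ^ 2 * ‖q‖ ^ 2 - s * ‖q‖ ^ 2 := by
    have h1 := lower y (x - s • q)
    have h2 := upper x (x - s • q)
    have e1 : x - s • q - y = (x - y) - s • q := by abel
    have e2 : x - s • q - x = -(s • q) := by abel
    rw [e1, norm_sub_sq_real, inner_sub_right, real_inner_smul_right, real_inner_smul_right,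
      norm_smul, mul_pow, Real.norm_eq_abs, sq_abs] at h1
    rw [e2, inner_neg_right, real_inner_smul_right, norm_neg, norm_smul, mul_pow,
      Real.norm_eq_abs, sq_abs] at h2
    have h3 : ‖q‖ ^ 2 = ⟪F' x, q⟫ - ⟪F' y, q⟫ - α * ⟪x - y, q⟫ := by
      rw [← real_inner_self_eq_norm_sq]
      nth_rw 1 [hq]
      rw [inner_sub_left, inner_sub_left, real_inner_smul_left]
    linear_combination h1 + h2 + s * h3
  set d := x - y with hd
  set q := F' x - F' y - α • d with hq
  have quad (s : ℝ) : 0 ≤ (β - α) * ‖q‖ ^ 2 * (s * s) + (-2 * ‖q‖ ^ 2) * s + ⟪q, d⟫ := by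
    have h1 := half x y q hq s
    have h2 := half y x (-q) (by rw [hq, hd]; module) s
    have e : y - x = -d := by rw [hd]; abel
    rw [← hd] at h1
    rw [e, inner_neg_right, norm_neg, norm_neg] at h2
    have h3 : ⟪q, d⟫ = ⟪F' x, d⟫ - ⟪F' y, d⟫ - α * ‖d‖ ^ 2 := by
      rw [hq, inner_sub_left, inner_sub_left, real_inner_smul_left, real_inner_self_eq_norm_sq]
    linear_combination h1 + h2 - h3
  have cocoercive : ‖q‖ ^ 2 ≤ (β - α) * ⟪q, d⟫ := by
    have hqd : 0 ≤ ⟪q, d⟫ := by simpa using quad 0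
    have hdisc := discrim_le_zero quad
    rw [discrim] at hdisc
    rcases (sq_nonneg ‖q‖).eq_or_lt with h0 | h0
    · rw [← h0]
      exact mul_nonneg (sub_nonneg.2 hαβ) hqd
    · refine le_of_mul_le_mul_left ?_ h0
      linarith
  refine le_of_sq_le_sq ?_ (mul_nonneg (by linarith) (norm_nonneg _))
  have e : (F' x - F' y) - ((α + β) / 2) • d = q - ((β - α) / 2) • d := by
    rw [hq]; module
  rw [e, norm_sub_sq_real, real_inner_smul_right, norm_smul, mul_pow, mul_pow,
    Real.norm_eq_abs, sq_abs]
  linarith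

/-- Contraction of the gradient step for a function between two quadratic models. -/
lemma norm_gradient_step_sub_le (hαβ : α ≤ β)
    (lower : ∀ u v, F u + ⟪F' u, v - u⟫ + α / 2 * ‖v - u‖ ^ 2 ≤ F v)
    (upper : ∀ u v, F v ≤ F u + ⟪F' u, v - u⟫ + β / 2 * ‖v - u‖ ^ 2)
    {η : ℝ} (hη : 0 ≤ η) (x y : E) :
    ‖(x - y) - η • (F' x - F' y)‖ ≤ max |1 - α * η| |1 - β * η| * ‖x - y‖ := by
  have h := norm_sub_midpoint_le hαβ lower upper x y
  have hcoef : |1 - (α + β) / 2 * η| + η * ((β - α) / 2) ≤ max |1 - α * η| |1 - β * η| := by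
    rcases abs_cases (1 - (α + β) / 2 * η) with ⟨h1, -⟩ | ⟨h1, -⟩
    · refine le_max_of_le_left (le_trans (le_of_eq ?_) (le_abs_self _))
      rw [h1]; ring
    · refine le_max_of_le_right (le_trans (le_of_eq ?_) (neg_le_abs _))
      rw [h1]; ring
  calc ‖(x - y) - η • (F' x - F' y)‖
      = ‖(1 - (α + β) / 2 * η) • (x - y)
          - η • ((F' x - F' y) - ((α + β) / 2) • (x - y))‖ := by congr 1; module
    _ ≤ |1 - (α + β) / 2 * η| * ‖x - y‖ + η * ((β - α) / 2 * ‖x - y‖) := by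
      refine (norm_sub_le _ _).trans ?_
      rw [norm_smul, norm_smul, Real.norm_eq_abs, Real.norm_of_nonneg hη]
      gcongr
    _ = (|1 - (α + β) / 2 * η| + η * ((β - α) / 2)) * ‖x - y‖ := by ring
    _ ≤ _ := by gcongr

lemma gradient_eq_zero_of_minimizer (hβ : 0 < β)
    (upper : ∀ u v, F v ≤ F u + ⟪F' u, v - u⟫ + β / 2 * ‖v - u‖ ^ 2)
    {x : E} (hx : ∀ z, F x ≤ F z) : F' x = 0 := by
  have h := (hx (x - β⁻¹ • F' x)).trans (upper x _)
  rw [sub_sub_cancel_left, inner_neg_right, real_inner_smul_right, norm_neg, norm_smul, mul_pow,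
    real_inner_self_eq_norm_sq, Real.norm_eq_abs, sq_abs] at h
  have e : β / 2 * (β⁻¹ ^ 2 * ‖F' x‖ ^ 2) = β⁻¹ / 2 * ‖F' x‖ ^ 2 := by
    field_simp
  rw [e] at h
  have hpos : 0 < β⁻¹ := inv_pos.2 hβ
  have : ‖F' x‖ ^ 2 ≤ 0 := by
    by_contra! hc
    nlinarith [mul_pos hpos hc]
  simpa using this

end QuadraticBounds

section SpectralRadius

lemma le_specRad_of_det_eq_zero {k : ℕ} (M : Matrix (Fin k) (Fin k) ℝ) {μ : ℝ}
    (hdet : (Matrix.scalar (Fin k) μ - M).det = 0) : μ ≤ specRad M := by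
  set A := M.map (algebraMap ℝ ℂ) with hA
  have hmem : (μ : ℂ) ∈ spectrum ℂ A := by
    rw [spectrum.mem_iff, Matrix.isUnit_iff_isUnit_det, isUnit_iff_ne_zero, not_not]
    have e : algebraMap ℂ (Matrix (Fin k) (Fin k) ℂ) μ - A =
        (algebraMap ℝ ℂ).mapMatrix (Matrix.scalar (Fin k) μ - M) := by
      ext i j
      by_cases hij : i = j <;> simp [hA, Matrix.algebraMap_matrix_apply, hij]
    rw [e, ← RingHom.map_det, hdet, map_zero]
  have hfin : spectralRadius ℂ A ≠ ⊤ := by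
    let _ : NormedRing (Matrix (Fin k) (Fin k) ℂ) := Matrix.linftyOpNormedRing
    let _ : NormedAlgebra ℂ (Matrix (Fin k) (Fin k) ℂ) := Matrix.linftyOpNormedAlgebra
    exact ((spectrum.spectralRadius_le_pow_nnnorm_pow_one_div ℂ A 0).trans_lt
      (by finiteness)).ne
  have hle : (‖(μ : ℂ)‖₊ : ENNReal) ≤ spectralRadius ℂ A :=
    le_iSup₂ (f := fun (z : ℂ) (_ : z ∈ spectrum ℂ A) => (‖z‖₊ : ENNReal)) (μ : ℂ) hmem
  have h := ENNReal.toReal_mono hfin hle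
  simp only [ENNReal.coe_toReal, coe_nnnorm, Complex.norm_real] at h
  exact (Real.le_norm_self μ).trans h

/-- An irreducible nonnegative matrix with this sparsity pattern has a positive left
eigenvector, whose eigenvalue is at most the spectral radius. -/
lemma exists_pos_left_eigenvector {a b c d e k l : ℝ} (hb : 0 < b) (hc : 0 < c) (hd : 0 < d)
    (hk : 0 < k) (hl : 0 ≤ l) (hea : e ≤ a) :
    ∃ μ p q r : ℝ, 0 < μ ∧ 0 < p ∧ 0 < q ∧ 0 < r ∧
      μ ≤ specRad !![a, b, c; d, e, 0; 0, k, l] ∧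
      p * a + q * d = μ * p ∧ p * b + q * e + r * k = μ * q ∧ p * c + r * l = μ * r := by
  set P : ℝ → ℝ := fun μ => (μ - l) * ((μ - e) * (μ - a) - b * d) - d * k * c with hP
  set m := max a l with hm
  have ha : a ≤ m := le_max_left _ _
  have hlm : l ≤ m := le_max_right _ _
  have hdkc : 0 < d * k * c := by positivity
  have hbd : 0 < b * d := by positivity
  have hneg : P m < 0 := by
    rcases le_total a l with h | h
    · have : m = l := max_eq_right h
      simp only [hP, this]
      linarith
    · have : m = a := max_eq_left h
      simp only [hP, this]
      nlinarith [mul_nonneg (sub_nonneg.2 h) hbd.le]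
  set M := m + 1 + b * d + d * k * c with hM
  have hpos : 0 ≤ P M := by
    have h1 : 1 ≤ M - l := by linarith
    have h2 : 1 ≤ M - e := by linarith
    have h3 : b * d + d * k * c ≤ M - a := by linarith
    have h4 : M - a ≤ (M - e) * (M - a) := by nlinarith
    have h5 : d * k * c ≤ (M - e) * (M - a) - b * d := by linarith
    have h6 : d * k * c ≤ (M - l) * ((M - e) * (M - a) - b * d) := by nlinarith
    simp only [hP]
    linarith
  obtain ⟨μ, ⟨hμm, -⟩, hμ⟩ := intermediate_value_Ioc (a := m) (b := M) (by linarith)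
    (f := P) (by simp only [hP]; fun_prop) ⟨hneg, hpos⟩
  have hμa : 0 < μ - a := by linarith
  have hμl : 0 < μ - l := by linarith
  refine ⟨μ, 1, (μ - a) / d, c / (μ - l), by linarith, one_pos, by positivity, by positivity,
    le_specRad_of_det_eq_zero _ ?_, ?_, ?_, ?_⟩
  · rw [Matrix.det_fin_three]
    simp
    simp only [hP] at hμ
    linear_combination hμ
  · field_simp
    ring
  · simp only [hP] at hμ
    field_simp
    linear_combination -hμ
  · field_simp
    ring

end SpectralRadius

/-- Scalar sequences dominated by a nonnegative linear recursion with this sparsity pattern decay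
at the rate of its spectral radius. -/
lemma exists_geometric_bound {a b c d e k l : ℝ} (hb : 0 < b) (hc : 0 < c) (hd : 0 < d)
    (hk : 0 < k) (hl : 0 ≤ l) (hea : e ≤ a) {u v w : ℕ → ℝ}
    (hu0 : ∀ t, 0 ≤ u t) (hv0 : ∀ t, 0 ≤ v t) (hw0 : ∀ t, 0 ≤ w t)
    (hu : ∀ t, u (t + 1) ≤ a * u t + b * v t + c * w t)
    (hv : ∀ t, v (t + 1) ≤ d * u t + e * v t)
    (hw : ∀ t, w (t + 1) ≤ k * v t + l * w t) :
    ∃ C : ℝ, 0 < C ∧ ∀ t, u t ≤ C * specRad !![a, b, c; d, e, 0; 0, k, l] ^ t ∧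
      v t ≤ C * specRad !![a, b, c; d, e, 0; 0, k, l] ^ t ∧
      w t ≤ C * specRad !![a, b, c; d, e, 0; 0, k, l] ^ t := by
  obtain ⟨μ, p, q, r, hμ, hp, hq, hr, hle, h1, h2, h3⟩ :=
    exists_pos_left_eigenvector hb hc hd hk hl hea
  set ρ := specRad !![a, b, c; d, e, 0; 0, k, l] with hρ
  set V : ℕ → ℝ := fun t => p * u t + q * v t + r * w t with hV
  have hV0 : 0 ≤ V 0 :=
    add_nonneg (add_nonneg (mul_nonneg hp.le (hu0 0)) (mul_nonneg hq.le (hv0 0)))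
      (mul_nonneg hr.le (hw0 0))
  have step (t : ℕ) : V (t + 1) ≤ μ * V t := by
    have hu' := mul_le_mul_of_nonneg_left (hu t) hp.le
    have hv' := mul_le_mul_of_nonneg_left (hv t) hq.le
    have hw' := mul_le_mul_of_nonneg_left (hw t) hr.le
    simp only [hV]
    linear_combination hu' + hv' + hw' + u t * h1 + v t * h2 + w t * h3
  have decay (t : ℕ) : V t ≤ (V 0 + 1) * ρ ^ t := by
    have h : V t ≤ V 0 * μ ^ t := by
      induction t with
      | zero => simp
      | succ t ih =>
        calc V (t + 1) ≤ μ * V t := step t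
          _ ≤ μ * (V 0 * μ ^ t) := by gcongr
          _ = V 0 * μ ^ (t + 1) := by ring
    refine h.trans (mul_le_mul (by linarith) ?_ (by positivity) (by positivity))
    exact pow_le_pow_left₀ hμ.le hle t
  have hρ0 : 0 ≤ ρ := hμ.le.trans hle
  set κ := min p (min q r) with hκ
  have hκ0 : 0 < κ := lt_min hp (lt_min hq hr)
  have hκp : κ ≤ p := min_le_left _ _
  have hκq : κ ≤ q := (min_le_right _ _).trans (min_le_left _ _)
  have hκr : κ ≤ r := (min_le_right _ _).trans (min_le_right _ _)
  refine ⟨(V 0 + 1) / κ, by positivity, fun t => ?_⟩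
  have hVt := decay t
  have hpu := mul_nonneg hp.le (hu0 t)
  have hqv := mul_nonneg hq.le (hv0 t)
  have hrw := mul_nonneg hr.le (hw0 t)
  have hpu' := mul_le_mul_of_nonneg_right hκp (hu0 t)
  have hqv' := mul_le_mul_of_nonneg_right hκq (hv0 t)
  have hrw' := mul_le_mul_of_nonneg_right hκr (hw0 t)
  simp only [div_mul_eq_mul_div, le_div_iff₀ hκ0]
  simp only [hV] at hVt ⊢
  refine ⟨?_, ?_, ?_⟩ <;> linarith

/-- The average of quadratic models of common curvature is a quadratic model of the average. -/
lemma average_quadratic_model {n N : ℕ} (hn : 0 < n) (y : Fin n → ℝ) (p : Fin n → Vec N)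
    (d : Vec N) (r : ℝ) :
    (n : ℝ)⁻¹ * ∑ i, (y i + ⟪p i, d⟫ + r) = (n : ℝ)⁻¹ * ∑ i, y i + ⟪rowMean p, d⟫ + r := by
  have hn' : (n : ℝ) ≠ 0 := by positivity
  rw [rowMean, real_inner_smul_left, sum_inner]
  simp only [Finset.sum_add_distrib, Finset.sum_const, Finset.card_univ, Fintype.card_fin,
    nsmul_eq_mul]
  field_simp

theorem statement9
    {n N : ℕ} (hn : 0 < n)
    (α β : ℝ) (hα : 0 < α) (hαβ : α ≤ β)
    (f : Fin n → Vec N → ℝ)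
    (hdiff : ∀ i, Differentiable ℝ (f i))
    (hstr : ∀ i, ∀ u v : Vec N,
      f i u + ⟪gradient (f i) u, v - u⟫ + α / 2 * ‖v - u‖ ^ 2 ≤ f i v)
    (hsmooth : ∀ i, ∀ u v : Vec N,
      ‖gradient (f i) u - gradient (f i) v‖ ≤ β * ‖u - v‖)
    (favg : Vec N → ℝ) (hfavg : ∀ z, favg z = (n : ℝ)⁻¹ * ∑ i, f i z)
    (xstar : Vec N) (hmin : ∀ z, favg xstar ≤ favg z)
    (W : Matrix (Fin n) (Fin n) ℝ)
    (hWnonneg : ∀ i j, 0 ≤ W i j)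
    (hWrow : ∀ i, ∑ j, W i j = 1)
    (hWcol : ∀ j, ∑ i, W i j = 1)
    (σ : ℝ)
    (hσ : σ = specNorm (W - (n : ℝ)⁻¹ • Matrix.of (fun _ _ => (1 : ℝ))))
    (hσ0 : 0 < σ) (hσ1 : σ < 1)
    (η : ℝ) (hη : 0 < η)
    (lam : ℝ) (hlam : lam = max |1 - α * η| |1 - β * η|)
    (G : Matrix (Fin 3) (Fin 3) ℝ)
    (hG : G = !![σ + β * η, β * (η * β + 2), η * β ^ 2;
                 η,         σ,               0;
                 0,         η * β,           lam])
    (hρ : specRad G < 1)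
    (x s : ℕ → Fin n → Vec N)
    (hs0 : ∀ i, s 0 i = gradient (f i) (x 0 i))
    (hxupd : ∀ t i, x (t + 1) i = (∑ j, W i j • x t j) - η • s t i)
    (hsupd : ∀ t i, s (t + 1) i =
      (∑ j, W i j • s t j) + gradient (f i) (x (t + 1) i) - gradient (f i) (x t i))
    (xbar g : ℕ → Vec N)
    (hxbar : ∀ t, xbar t = (n : ℝ)⁻¹ • ∑ i, x t i)
    (hg : ∀ t, g t = (n : ℝ)⁻¹ • ∑ i, gradient (f i) (x t i)) :
    ∃ C : ℝ, 0 < C ∧ ∀ t : ℕ, ∀ i : Fin n,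
      ‖xbar t - xstar‖ ≤ C * specRad G ^ t ∧
      fro (fun j => x t j - xbar t) ≤ C * specRad G ^ t ∧
      fro (fun j => s t j - g t) ≤ C * specRad G ^ t ∧
      favg (x t i) - favg xstar ≤ C * specRad G ^ (2 * t) := by
  have hβ : 0 < β := hα.trans_le hαβ
  have hsqrt : 1 ≤ √(n : ℝ) := Real.one_le_sqrt.2 (by exact_mod_cast hn)
  set F' : Vec N → Vec N := fun z => rowMean fun i => gradient (f i) z with hF'
  have lower (u v : Vec N) :
      favg u + ⟪F' u, v - u⟫ + α / 2 * ‖v - u‖ ^ 2 ≤ favg v := by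
    rw [hfavg, hfavg, hF', ← average_quadratic_model hn]
    gcongr with i
    exact hstr i u v
  have upper (u v : Vec N) :
      favg v ≤ favg u + ⟪F' u, v - u⟫ + β / 2 * ‖v - u‖ ^ 2 := by
    rw [hfavg, hfavg, hF', ← average_quadratic_model hn]
    gcongr with i
    exact le_quadratic_of_gradient_lipschitz (hdiff i) (hsmooth i) u v
  have hcrit : F' xstar = 0 := gradient_eq_zero_of_minimizer hβ upper hmin
  have lipschitz (A B : Fin n → Vec N) :
      fro ((fun i => gradient (f i) (A i)) - fun i => gradient (f i) (B i)) ≤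
        β * fro (A - B) :=
    fro_le_mul_fro hβ.le fun i => hsmooth i (A i) (B i)
  have xbar_eq (t : ℕ) : xbar t = rowMean (x t) := hxbar t
  have g_eq (t : ℕ) : g t = rowMean fun i => gradient (f i) (x t i) := hg t
  have x_eq (t : ℕ) : x (t + 1) = mix W (x t) - η • s t := funext fun i => hxupd t i
  have s_eq (t : ℕ) : s (t + 1) = mix W (s t) +
      ((fun i => gradient (f i) (x (t + 1) i)) - fun i => gradient (f i) (x t i)) :=
    funext fun i => (hsupd t i).trans (add_sub_assoc _ _ _)
  have mean_s (t : ℕ) : rowMean (s t) = g t := by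
    induction t with
    | zero => rw [g_eq]; congr 1; exact funext hs0
    | succ t ih =>
      rw [s_eq, rowMean_add, rowMean_sub, rowMean_mix hWcol, ih, ← g_eq, ← g_eq]
      abel
  have mean_x (t : ℕ) : xbar (t + 1) = xbar t - η • g t := by
    rw [xbar_eq, x_eq, rowMean_sub, rowMean_smul, rowMean_mix hWcol, mean_s, ← xbar_eq]
  have mix_x (t : ℕ) : fro (fun i => mix W (x t) i - xbar t) ≤
      σ * fro (fun i => x t i - xbar t) := by
    rw [hσ, xbar_eq]
    exact fro_mix_deviation_le hn hWrow (x t)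
  have mix_s (t : ℕ) : fro (fun i => mix W (s t) i - g t) ≤
      σ * fro (fun i => s t i - g t) := by
    rw [hσ, ← mean_s]
    exact fro_mix_deviation_le hn hWrow (s t)
  have gradient_gap (t : ℕ) : √n * ‖g t - F' (xbar t)‖ ≤
      β * fro (fun i => x t i - xbar t) := by
    rw [g_eq, hF', ← rowMean_sub]
    exact (sqrt_mul_norm_rowMean_le hn _).trans (lipschitz (x t) fun _ => xbar t)
  have gradient_avg (t : ℕ) : √n * ‖F' (xbar t)‖ ≤ β * (√n * ‖xbar t - xstar‖) := by
    have h := (sqrt_mul_norm_rowMean_le hn _).trans (lipschitz (fun _ => xbar t) fun _ => xstar)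
    rw [rowMean_sub, show (fun _ : Fin n => xbar t) - (fun _ => xstar) =
      fun _ => xbar t - xstar from rfl, fro_const] at h
    change √n * ‖F' (xbar t) - F' xstar‖ ≤ _ at h
    rwa [hcrit, sub_zero] at h
  have optimality (t : ℕ) : √n * ‖xbar (t + 1) - xstar‖ ≤
      η * β * fro (fun i => x t i - xbar t) + lam * (√n * ‖xbar t - xstar‖) := by
    have hstep := norm_gradient_step_sub_le hαβ lower upper hη.le (xbar t) xstar
    rw [hcrit, sub_zero, ← hlam] at hstep
    have e : xbar (t + 1) - xstar =
        (xbar t - xstar - η • F' (xbar t)) - η • (g t - F' (xbar t)) := by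
      rw [mean_x]; module
    have h : ‖xbar (t + 1) - xstar‖ ≤
        lam * ‖xbar t - xstar‖ + η * ‖g t - F' (xbar t)‖ := by
      rw [e]
      refine (norm_sub_le _ _).trans ?_
      rw [norm_smul, Real.norm_of_nonneg hη.le]
      gcongr
    have h1 := mul_le_mul_of_nonneg_left h (Real.sqrt_nonneg n)
    have h2 := mul_le_mul_of_nonneg_left (gradient_gap t) hη.le
    linarith
  have consensus (t : ℕ) : fro (fun i => x (t + 1) i - xbar (t + 1)) ≤
      η * fro (fun i => s t i - g t) + σ * fro (fun i => x t i - xbar t) := by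
    have e : (fun i => x (t + 1) i - xbar (t + 1)) =
        (fun i => mix W (x t) i - xbar t) - η • fun i => s t i - g t := by
      funext i
      simp only [x_eq, mean_x, Pi.sub_apply, Pi.smul_apply]
      module
    rw [e]
    refine (fro_sub_le _ _).trans ?_
    rw [fro_smul, abs_of_pos hη]
    linarith [mix_x t]
  have increment (t : ℕ) : fro (x (t + 1) - x t) ≤
      η * fro (fun i => s t i - g t) + (η * β + 2) * fro (fun i => x t i - xbar t) +
        η * β * (√n * ‖xbar t - xstar‖) := by
    have e : x (t + 1) - x t =
        (fun i => mix W (x t) i - xbar t) - (fun i => x t i - xbar t) -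
          η • (fun i => s t i - g t) - η • fun _ => g t := by
      funext i
      simp only [x_eq, Pi.sub_apply, Pi.smul_apply]
      module
    have h1 : √n * ‖g t‖ ≤ √n * ‖g t - F' (xbar t)‖ + √n * ‖F' (xbar t)‖ := by
      rw [← mul_add]
      gcongr
      exact norm_le_norm_sub_add _ _
    have h2 := mul_le_mul_of_nonneg_left
      (h1.trans (add_le_add (gradient_gap t) (gradient_avg t))) hη.le
    have h3 : σ * fro (fun i => x t i - xbar t) ≤ 1 * fro (fun i => x t i - xbar t) :=
      mul_le_mul_of_nonneg_right hσ1.le (fro_nonneg _)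
    rw [e]
    refine (fro_sub_le _ _).trans ?_
    rw [fro_smul, fro_const, abs_of_pos hη]
    have h4 := fro_sub_le ((fun i => mix W (x t) i - xbar t) - fun i => x t i - xbar t)
      (η • fun i => s t i - g t)
    rw [fro_smul, abs_of_pos hη] at h4
    have h5 := fro_sub_le (fun i => mix W (x t) i - xbar t) (fun i => x t i - xbar t)
    linarith [mix_x t]
  have tracking (t : ℕ) : fro (fun i => s (t + 1) i - g (t + 1)) ≤
      (σ + β * η) * fro (fun i => s t i - g t) +
        β * (η * β + 2) * fro (fun i => x t i - xbar t) +
        η * β ^ 2 * (√n * ‖xbar t - xstar‖) := by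
    set D : Fin n → Vec N :=
      (fun i => gradient (f i) (x (t + 1) i)) - fun i => gradient (f i) (x t i) with hD
    have hmean : g (t + 1) = g t + rowMean D := by
      rw [hD, rowMean_sub, ← g_eq, ← g_eq]; abel
    have e : (fun i => s (t + 1) i - g (t + 1)) =
        (fun i => mix W (s t) i - g t) + fun i => D i - rowMean D := by
      funext i
      simp only [s_eq, hmean, Pi.add_apply, ← hD]
      abel
    rw [e]
    refine (fro_add_le _ _).trans ?_
    have h1 := (fro_deviation_le hn D).trans (lipschitz (x (t + 1)) (x t))
    have h2 := mul_le_mul_of_nonneg_left (increment t) hβ.le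
    linarith [mix_s t]
  have hlam0 : 0 ≤ lam := hlam ▸ le_max_of_le_left (abs_nonneg _)
  obtain ⟨C, hC, hbound⟩ := exists_geometric_bound (a := σ + β * η) (b := β * (η * β + 2))
    (c := η * β ^ 2) (d := η) (e := σ) (k := η * β) (l := lam)
    (by positivity) (by positivity) hη (by positivity) hlam0
    (le_add_of_nonneg_right (by positivity))
    (fun t => fro_nonneg fun i => s t i - g t) (fun t => fro_nonneg fun i => x t i - xbar t)
    (fun t => by positivity) tracking consensus optimality
  rw [← hG] at hbound
  refine ⟨max C (2 * β * C ^ 2), lt_max_of_lt_left hC, fun t i => ?_⟩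
  obtain ⟨hs, hx, hopt⟩ := hbound t
  have hρ0 : 0 ≤ specRad G := ENNReal.toReal_nonneg
  have hweak : C * specRad G ^ t ≤ max C (2 * β * C ^ 2) * specRad G ^ t := by
    gcongr
    exact le_max_left _ _
  have hbar : ‖xbar t - xstar‖ ≤ C * specRad G ^ t :=
    (le_mul_of_one_le_left (norm_nonneg _) hsqrt).trans hopt
  refine ⟨hbar.trans hweak, hx.trans hweak, hs.trans hweak, ?_⟩
  have hxi : ‖x t i - xstar‖ ≤ 2 * (C * specRad G ^ t) := by
    have h1 := (norm_le_fro (fun j => x t j - xbar t) i).trans hx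
    have h2 := norm_sub_le_norm_sub_add_norm_sub (x t i) (xbar t) xstar
    linarith
  have hup := upper xstar (x t i)
  rw [hcrit, inner_zero_left, add_zero] at hup
  calc favg (x t i) - favg xstar ≤ β / 2 * ‖x t i - xstar‖ ^ 2 := by linarith
    _ ≤ β / 2 * (2 * (C * specRad G ^ t)) ^ 2 := by gcongr
    _ = 2 * β * C ^ 2 * specRad G ^ (2 * t) := by ring
    _ ≤ max C (2 * β * C ^ 2) * specRad G ^ (2 * t) := by
      gcongr
      exact le_max_right _ _
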